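/- arXiv:1206.3543 — 5 statements merged into one kernel-verified Lean document; each statement's English description precedes it below -/
import Mathlib

section
/- For all natural numbers n ≥ 1 and x with x ≤ n, the evidence defined with C_V = 1/2 and two-sided evidential volume has the exact closed form E(n,x) = ( (n+1) · C(n,x) · (x/n)^x · ((n−x)/n)^{n−x} )², where C(n,x) is the binomial coefficient (with the convention 0^0 = 1). -/
open MeasureTheory

/-- Two-sided evidential volume `V_E(n,x) = ∫₀¹ 2^n θ^x (1−θ)^{n−x} dθ`. -/
noncomputable def VE (n x : ℕ) : ℝ :=
  ∫ θ in (0:ℝ)..1, (2:ℝ) ^ n * θ ^ x * (1 - θ) ^ (n - x)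

/-- Evidential entropy (additive constant `k = 0`); `Real.log 0 = 0` encodes the
convention `0·log 0 = 0`. -/
noncomputable def SE (n x : ℕ) : ℝ :=
  x * Real.log (x / n) + ((n : ℝ) - x) * Real.log (((n : ℝ) - x) / n) + n * Real.log 2

/-- The evidence with `R = 1`, `C_V = 1/2`: `E = exp(2 S_E)/V_E²`. -/
noncomputable def Ev (n x : ℕ) : ℝ := Real.exp (2 * SE n x) / (VE n x) ^ 2

theorem beta_aux (b : ℕ) : ∀ a : ℕ,
    (∫ θ in (0:ℝ)..1, θ ^ a * (1 - θ) ^ b) * ((a + b + 1).factorial : ℝ)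
      = a.factorial * b.factorial := by
  induction b with
  | zero =>
    intro a
    have : (a : ℝ) + 1 ≠ 0 := by positivity
    simp [integral_pow, Nat.factorial_succ]
    field_simp
  | succ b ih =>
    intro a
    have key : (∫ θ in (0:ℝ)..1, (((a:ℝ) + 1) * (θ ^ a * (1 - θ) ^ (b + 1))
        - ((b:ℝ) + 1) * (θ ^ (a + 1) * (1 - θ) ^ b))) = 0 := by
      have h := intervalIntegral.integral_eq_sub_of_hasDerivAt (a := (0:ℝ)) (b := 1)
        (f := fun θ : ℝ => θ ^ (a + 1) * (1 - θ) ^ (b + 1))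
        (f' := fun θ : ℝ => (((a:ℝ) + 1) * (θ ^ a * (1 - θ) ^ (b + 1))
        - ((b:ℝ) + 1) * (θ ^ (a + 1) * (1 - θ) ^ b))) ?_ ?_
      · rw [h]; simp
      · intro θ _
        have h1 := hasDerivAt_pow (a + 1) θ
        have h2 := ((hasDerivAt_id θ).const_sub 1).pow (b + 1)
        refine (h1.mul h2).congr_deriv ?_
        simp
        ring
      · apply Continuous.intervalIntegrable
        fun_prop
    rw [intervalIntegral.integral_sub, intervalIntegral.integral_const_mul,
      intervalIntegral.integral_const_mul] at key
    · have h := ih (a + 1)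
      have e : a + 1 + b + 1 = a + (b + 1) + 1 := by ring
      rw [e, Nat.factorial_succ a] at h
      rw [Nat.factorial_succ b]
      push_cast at h ⊢
      have ha : (a : ℝ) + 1 ≠ 0 := by positivity
      apply mul_left_cancel₀ ha
      linear_combination ((a + (b + 1) + 1).factorial : ℝ) * key + ((b:ℝ) + 1) * h
    · apply Continuous.intervalIntegrable
      fun_prop
    · apply Continuous.intervalIntegrable
      fun_prop

theorem exp_aux (k : ℕ) (y : ℝ) (hy : k ≠ 0 → 0 < y) :
    Real.exp (k * Real.log y) = y ^ k := by
  rcases Nat.eq_zero_or_pos k with h | h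
  · subst h; simp
  · rw [Real.exp_nat_mul, Real.exp_log (hy h.ne')]

theorem VE_aux (n x : ℕ) (hx : x ≤ n) :
    VE n x * (((n : ℝ) + 1) * (n.choose x)) = 2 ^ n := by
  have h := beta_aux (n - x) x
  have e : x + (n - x) + 1 = n + 1 := by omega
  rw [e, Nat.factorial_succ] at h
  have hc : ((n.choose x : ℕ) : ℝ) * x.factorial * (n - x).factorial = n.factorial := by
    exact_mod_cast Nat.choose_mul_factorial_mul_factorial hx
  have hV : VE n x = 2 ^ n * ∫ θ in (0:ℝ)..1, θ ^ x * (1 - θ) ^ (n - x) := by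
    unfold VE
    rw [← intervalIntegral.integral_const_mul]
    simp only [mul_assoc]
  rw [hV]
  push_cast at h
  have h0 : (x.factorial : ℝ) * (n - x).factorial ≠ 0 := by positivity
  apply mul_right_cancel₀ h0
  rw [← hc] at h
  linear_combination (2:ℝ) ^ n * h

/-- For `n ≥ 1`, `x ≤ n`, the evidence has the exact closed form
`E(n,x) = ((n+1)·C(n,x)·(x/n)^x·((n−x)/n)^{n−x})²` (natural-number powers, so `0^0 = 1`). -/
theorem evidence_closed_form (n x : ℕ) (hn : 1 ≤ n) (hx : x ≤ n) :
    Ev n x =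
      (((n : ℝ) + 1) * (n.choose x) * ((x : ℝ) / n) ^ x *
        (((n : ℝ) - x) / n) ^ (n - x)) ^ 2 := by
  have hn' : (0:ℝ) < n := by exact_mod_cast hn
  have hV := VE_aux n x hx
  have hS : Real.exp (SE n x) = ((x : ℝ) / n) ^ x * (((n : ℝ) - x) / n) ^ (n - x) * 2 ^ n := by
    unfold SE
    rw [Real.exp_add, Real.exp_add, exp_aux x, exp_aux n 2 (by norm_num),
      ← Nat.cast_sub hx, exp_aux (n - x)]
    · intro h
      have : (0:ℝ) < (n - x : ℕ) := by exact_mod_cast Nat.pos_of_ne_zero h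
      positivity
    · intro h
      have : (0:ℝ) < (x : ℕ) := by exact_mod_cast Nat.pos_of_ne_zero h
      positivity
  have hV0 : VE n x ≠ 0 := by
    intro h
    rw [h, zero_mul] at hV
    exact absurd hV.symm (by positivity)
  have h2 : Real.exp (2 * SE n x) = Real.exp (SE n x) ^ 2 := by
    rw [← Real.exp_nat_mul]; norm_num
  unfold Ev
  rw [h2, ← div_pow, hS, ← hV]
  congr 1
  field_simp
end

section
/- Let t ∈ (0,1) and let (x_n) be a sequence of natural numbers with 1 ≤ x_n ≤ n−1 and x_n/n → t as n → ∞. Then the Stirling approximation of the Beta factor holds in the ratio sense: ( x_n!·(n−x_n)!/(n+1)! ) / ( (x_n^{x_n}·(n−x_n)^{n−x_n}/(n+1)^{n+1}) · e · √(2π·x_n·(n−x_n)/(n+1)) ) → 1 as n → ∞. -/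
open Filter

lemma fact_eq_aux (k : ℕ) (hk : 1 ≤ k) : (Nat.factorial k : ℝ) =
    Stirling.stirlingSeq k * (Real.sqrt 2 * Real.sqrt k * ((k:ℝ) ^ k / Real.exp 1 ^ k)) := by
  have hk' : (0:ℝ) < k := by exact_mod_cast hk
  unfold Stirling.stirlingSeq
  rw [Real.sqrt_mul (by norm_num), div_pow]
  rw [div_mul_cancel₀]
  positivity

lemma ratio_aux (a b : ℕ) (ha : 1 ≤ a) (hb : 1 ≤ b) :
    ((Nat.factorial a : ℝ) * (Nat.factorial b) / (Nat.factorial (a + b + 1))) /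
      (((a : ℝ) ^ a * (b : ℝ) ^ b / (((a + b : ℕ) : ℝ) + 1) ^ (a + b + 1)) *
        Real.exp 1 *
        Real.sqrt (2 * Real.pi * (a : ℝ) * (b : ℝ) / (((a + b : ℕ) : ℝ) + 1)))
    = Stirling.stirlingSeq a * Stirling.stirlingSeq b /
      (Stirling.stirlingSeq (a + b + 1) * Real.sqrt Real.pi) := by
  have ha' : (0:ℝ) < a := by exact_mod_cast ha
  have hb' : (0:ℝ) < b := by exact_mod_cast hb
  have hS : 0 < Stirling.stirlingSeq (a + b + 1) := Stirling.stirlingSeq'_pos _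
  rw [fact_eq_aux a ha, fact_eq_aux b hb, fact_eq_aux (a + b + 1) (by omega)]
  have hc : ((a + b : ℕ) : ℝ) + 1 = ((a + b + 1 : ℕ) : ℝ) := by push_cast; ring
  rw [hc]
  have hc' : (0:ℝ) < ((a + b + 1 : ℕ) : ℝ) := by positivity
  generalize ((a + b + 1 : ℕ) : ℝ) = c at *
  rw [Real.sqrt_div (by positivity), Real.sqrt_mul (by positivity), Real.sqrt_mul (by positivity),
    Real.sqrt_mul (by positivity)]
  have h2 : 0 < Real.sqrt 2 := by positivity
  have hp : 0 < Real.sqrt Real.pi := Real.sqrt_pos.2 Real.pi_pos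
  have hsa := Real.sqrt_pos.2 ha'
  have hsb := Real.sqrt_pos.2 hb'
  have hsc := Real.sqrt_pos.2 hc'
  have he := Real.exp_pos 1
  have hpa : 0 < (a:ℝ) ^ a := by positivity
  have hpb : 0 < (b:ℝ) ^ b := by positivity
  have hpc : 0 < c ^ (a + b + 1) := by positivity
  rw [pow_succ (Real.exp 1), pow_add (Real.exp 1)]
  have hea : 0 < Real.exp 1 ^ a := by positivity
  have heb : 0 < Real.exp 1 ^ b := by positivity
  generalize Real.exp 1 ^ a = ea at *
  generalize Real.exp 1 ^ b = eb at *
  generalize (a:ℝ) ^ a = pa at *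
  generalize (b:ℝ) ^ b = pb at *
  generalize c ^ (a + b + 1) = pc at *
  generalize Real.sqrt c = sc at *
  generalize Real.sqrt a = sa at *
  generalize Real.sqrt b = sb at *
  generalize Real.sqrt 2 = s2 at *
  generalize Real.sqrt Real.pi = sp at *
  generalize Real.exp 1 = e at *
  field_simp

/-- If `1 ≤ x_n ≤ n−1` and `x_n/n → t ∈ (0,1)`, then the Stirling
approximation of the Beta factor holds in the ratio sense:
`(x_n!·(n−x_n)!/(n+1)!) / ((x_n^{x_n}·(n−x_n)^{n−x_n}/(n+1)^{n+1})·e·√(2π·x_n·(n−x_n)/(n+1))) → 1`. -/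
theorem stirling_beta_factor (t : ℝ) (ht : t ∈ Set.Ioo (0:ℝ) 1) (x : ℕ → ℕ)
    (hx : ∀ n, 2 ≤ n → 1 ≤ x n ∧ x n ≤ n - 1)
    (hlim : Tendsto (fun n : ℕ => (x n : ℝ) / n) atTop (nhds t)) :
    Tendsto
      (fun n : ℕ =>
        ((Nat.factorial (x n) : ℝ) * (Nat.factorial (n - x n)) / (Nat.factorial (n + 1))) /
          (((x n : ℝ) ^ (x n) * ((n : ℝ) - x n) ^ (n - x n) / ((n : ℝ) + 1) ^ (n + 1)) *
            Real.exp 1 *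
            Real.sqrt (2 * Real.pi * (x n : ℝ) * ((n : ℝ) - x n) / ((n : ℝ) + 1))))
      atTop (nhds 1) := by
  obtain ⟨ht0, ht1⟩ := ht
  have hn : Tendsto (fun n : ℕ => (n : ℝ)) atTop atTop := tendsto_natCast_atTop_atTop
  have hX : Tendsto x atTop atTop := by
    rw [← tendsto_natCast_atTop_iff (R := ℝ)]
    refine (hlim.pos_mul_atTop ht0 hn).congr' ?_
    filter_upwards [eventually_ge_atTop 2] with n h2
    have : (0:ℝ) < n := by exact_mod_cast (by omega : 0 < n)
    field_simp
  have hY : Tendsto (fun n => n - x n) atTop atTop := by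
    rw [← tendsto_natCast_atTop_iff (R := ℝ)]
    refine ((hlim.const_sub 1).pos_mul_atTop (sub_pos.2 ht1) hn).congr' ?_
    filter_upwards [eventually_ge_atTop 2] with n h2
    have : (0:ℝ) < n := by exact_mod_cast (by omega : 0 < n)
    have h := hx n h2
    rw [Nat.cast_sub (by omega)]
    field_simp
  have hS := Stirling.tendsto_stirlingSeq_sqrt_pi
  have hp : 0 < Real.sqrt Real.pi := Real.sqrt_pos.2 Real.pi_pos
  have hmain := ((hS.comp hX).mul (hS.comp hY)).div
    ((hS.comp (tendsto_add_atTop_nat 1)).mul_const (Real.sqrt Real.pi)) (by positivity)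
  rw [div_self (by positivity)] at hmain
  refine hmain.congr' ?_
  filter_upwards [eventually_ge_atTop 2] with n h2
  have h := hx n h2
  have key := ratio_aux (x n) (n - x n) h.1 (by omega)
  rw [show x n + (n - x n) = n by omega, Nat.cast_sub (by omega : x n ≤ n)] at key
  exact key.symm
end

section
/- Let t ∈ (0,1) and let (x_n) be a sequence of natural numbers with 1 ≤ x_n ≤ n−1 and x_n/n → t as n → ∞. Then E(n,x_n) · 2π·x_n·(n−x_n)/(n+1)³ → 1 as n → ∞; that is, E(n,x_n) is asymptotically equal to E_APPROX(n,x_n) = (n+1)³/(2π·x_n·(n−x_n)). -/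
open MeasureTheory Filter

theorem beta_nat (a b : ℕ) :
    ∫ θ in (0:ℝ)..1, θ ^ a * (1 - θ) ^ b
      = (a.factorial : ℝ) * b.factorial / ((a + b + 1).factorial : ℝ) := by
  have h := Complex.betaIntegral_eq_Gamma_mul_div ((a:ℂ) + 1) ((b:ℂ) + 1)
    (by simp; positivity) (by simp; positivity)
  have e : (a:ℂ) + 1 + (b + 1) = ((a + b + 1 : ℕ) : ℂ) + 1 := by push_cast; ring
  rw [e, Complex.Gamma_nat_eq_factorial, Complex.Gamma_nat_eq_factorial,
    Complex.Gamma_nat_eq_factorial, Complex.betaIntegral] at h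
  simp only [add_sub_cancel_right, Complex.cpow_natCast] at h
  have h2 : ((∫ θ in (0:ℝ)..1, θ ^ a * (1 - θ) ^ b : ℝ) : ℂ)
      = (((a.factorial : ℝ) * b.factorial / ((a + b + 1).factorial : ℝ) : ℝ) : ℂ) := by
    rw [← intervalIntegral.integral_ofReal]
    push_cast
    exact h
  exact_mod_cast h2

theorem fact_stirling (n : ℕ) (hn : 1 ≤ n) :
    ((n.factorial : ℝ)) ^ 2 =
      Stirling.stirlingSeq n ^ 2 * (2 * n) * ((n:ℝ) ^ n / Real.exp n) ^ 2 := by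
  have hn' : (0:ℝ) < n := by exact_mod_cast hn
  have h : (n.factorial : ℝ)
      = Stirling.stirlingSeq n * (Real.sqrt (2 * n) * ((n:ℝ) ^ n / Real.exp n)) := by
    have : Real.exp (n:ℝ) = Real.exp 1 ^ n := by rw [← Real.exp_nat_mul, mul_one]
    rw [Stirling.stirlingSeq, this, ← div_pow, div_mul_cancel₀]
    positivity
  rw [h, mul_pow, mul_pow, Real.sq_sqrt (by positivity)]
  ring

theorem exp_mul_log (k : ℕ) (y : ℝ) (hy : 0 < y) : Real.exp (k * Real.log y) = y ^ k := by
  rw [Real.exp_nat_mul, Real.exp_log hy]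

theorem stirling_ne (n : ℕ) (hn : 1 ≤ n) : Stirling.stirlingSeq n ≠ 0 := by
  obtain ⟨m, rfl⟩ := Nat.exists_eq_add_of_le' hn
  exact (Stirling.stirlingSeq'_pos m).ne'

theorem ev_formula (a b : ℕ) (ha : 1 ≤ a) (hb : 1 ≤ b) :
    Ev (a + b) a * (2 * Real.pi * (a : ℝ) * (((a + b : ℕ) : ℝ) - a) / (((a + b : ℕ) : ℝ) + 1) ^ 3)
    = Real.pi * Stirling.stirlingSeq (a + b) ^ 2 /
      (Stirling.stirlingSeq a ^ 2 * Stirling.stirlingSeq b ^ 2) *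
      (((a + b : ℕ) : ℝ) / (((a + b : ℕ) : ℝ) + 1)) := by
  have ha' : (0:ℝ) < a := by exact_mod_cast ha
  have hb' : (0:ℝ) < b := by exact_mod_cast hb
  have hV : VE (a + b) a ^ 2 = ((2:ℝ) ^ (a + b)) ^ 2 * ((a.factorial : ℝ) ^ 2 * (b.factorial : ℝ) ^ 2
      / (((a:ℝ) + b + 1) ^ 2 * ((a + b).factorial : ℝ) ^ 2)) := by
    have : VE (a + b) a = (2:ℝ) ^ (a + b) * ((a.factorial : ℝ) * b.factorial /
        ((a + b + 1).factorial : ℝ)) := by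
      rw [← beta_nat, ← intervalIntegral.integral_const_mul, VE]
      simp only [Nat.add_sub_cancel_left, mul_assoc]
    rw [this, Nat.factorial_succ]
    push_cast
    rw [mul_pow, div_pow, mul_pow, mul_pow]
  have hb2 : ((a + b : ℕ) : ℝ) - a = b := by push_cast; ring
  have hS : Real.exp (2 * SE (a + b) a)
      = (((a:ℝ) / ((a + b : ℕ) : ℝ)) ^ a * ((b:ℝ) / ((a + b : ℕ) : ℝ)) ^ b * 2 ^ (a + b)) ^ 2 := by
    have h2 : (2:ℝ) * SE (a + b) a = ((2:ℕ):ℝ) * SE (a + b) a := by norm_num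
    rw [h2, Real.exp_nat_mul, SE, hb2, Real.exp_add, Real.exp_add,
      exp_mul_log _ _ (by positivity), exp_mul_log _ _ (by positivity),
      exp_mul_log _ _ (by norm_num)]
  have e1 : Real.exp ((a + b : ℕ) : ℝ) = Real.exp a * Real.exp b := by
    rw [← Real.exp_add]; push_cast; rfl
  have s1 := stirling_ne a ha
  have s2 := stirling_ne b hb
  have s3 := stirling_ne (a + b) (by omega)
  rw [Ev, hV, hS, hb2, fact_stirling a ha, fact_stirling b hb, fact_stirling (a + b) (by omega), e1]
  push_cast
  have hn : (0:ℝ) < (a:ℝ) + b := by positivity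
  generalize (a:ℝ) + b = N at *
  have := Real.exp_pos (a:ℝ)
  have := Real.exp_pos (b:ℝ)
  generalize Real.exp (a:ℝ) = A at *
  generalize Real.exp (b:ℝ) = B at *
  generalize Stirling.stirlingSeq a = sa at *
  generalize Stirling.stirlingSeq b = sb at *
  generalize Stirling.stirlingSeq (a + b) = sn at *
  have hpa : (0:ℝ) < (a:ℝ) ^ a := by positivity
  have hpb : (0:ℝ) < (b:ℝ) ^ b := by positivity
  have hNa : (0:ℝ) < N ^ a := by positivity
  have hNb : (0:ℝ) < N ^ b := by positivity
  have h2 : (0:ℝ) < 2 ^ (a + b) := by positivity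
  rw [div_pow, div_pow, pow_add N]
  generalize (a:ℝ) ^ a = pa at *
  generalize (b:ℝ) ^ b = pb at *
  generalize N ^ a = Na at *
  generalize N ^ b = Nb at *
  generalize (2:ℝ) ^ (a + b) = T at *
  field_simp

/-- If `1 ≤ x_n ≤ n−1` and `x_n/n → t ∈ (0,1)`, then
`E(n,x_n) · 2π·x_n·(n−x_n)/(n+1)³ → 1`, i.e. `E(n,x_n)` is asymptotically equal to
`E_APPROX(n,x_n) = (n+1)³/(2π·x_n·(n−x_n))`. -/
theorem evidence_asymptotic (t : ℝ) (ht : t ∈ Set.Ioo (0:ℝ) 1) (x : ℕ → ℕ)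
    (hx : ∀ n, 2 ≤ n → 1 ≤ x n ∧ x n ≤ n - 1)
    (hlim : Tendsto (fun n : ℕ => (x n : ℝ) / n) atTop (nhds t)) :
    Tendsto
      (fun n : ℕ =>
        Ev n (x n) * (2 * Real.pi * (x n : ℝ) * ((n : ℝ) - x n) / ((n : ℝ) + 1) ^ 3))
      atTop (nhds 1) := by
  obtain ⟨ht0, ht1⟩ := ht
  have hN : Tendsto (fun n : ℕ => (n : ℝ)) atTop atTop := tendsto_natCast_atTop_atTop
  have hxa : Tendsto x atTop atTop := by
    rw [← tendsto_natCast_atTop_iff (R := ℝ)]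
    refine (hlim.pos_mul_atTop ht0 hN).congr' ?_
    filter_upwards [eventually_ge_atTop 1] with n hn
    have : (0:ℝ) < n := by exact_mod_cast hn
    field_simp
  have hxb : Tendsto (fun n => n - x n) atTop atTop := by
    rw [← tendsto_natCast_atTop_iff (R := ℝ)]
    refine ((hlim.const_sub 1).pos_mul_atTop (sub_pos.2 ht1) hN).congr' ?_
    filter_upwards [eventually_ge_atTop 2] with n hn
    have : (0:ℝ) < n := by exact_mod_cast (by omega : 0 < n)
    rw [Nat.cast_sub (by have := hx n hn; omega)]
    field_simp
  have S := Stirling.tendsto_stirlingSeq_sqrt_pi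
  have hp : Real.sqrt Real.pi ^ 2 ≠ 0 := by have := Real.pi_pos; positivity
  have L := (((S.pow 2).const_mul Real.pi).div (((S.comp hxa).pow 2).mul ((S.comp hxb).pow 2))
    (mul_ne_zero hp hp)).mul (tendsto_natCast_div_add_atTop (1:ℝ))
  have e : Real.pi * Real.sqrt Real.pi ^ 2 / (Real.sqrt Real.pi ^ 2 * Real.sqrt Real.pi ^ 2) * 1
      = 1 := by
    rw [Real.sq_sqrt Real.pi_pos.le]
    have := Real.pi_pos
    field_simp
  rw [e] at L
  refine L.congr' ?_
  filter_upwards [eventually_ge_atTop 2] with n hn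
  obtain ⟨h1, h2⟩ := hx n hn
  have := ev_formula (x n) (n - x n) h1 (by omega)
  rw [Nat.add_sub_cancel' (by omega : x n ≤ n)] at this
  rw [this]
  rfl
end

section
/- Fix a real n > 0 and C_V > 0, and on 0 < x < n/2 define the one-sided evidence E(x) = exp(S_E(x)/C_V) / V_E(x)^{1/C_V}, where V_E(x) = ∫₀^{1/2} 2^n θ^x (1−θ)^{n−x} dθ and S_E(x) = x·log(x/n) + (n−x)·log((n−x)/n) + n·log 2. Then log E is differentiable on (0, n/2) with d/dx log E(x) = (1/C_V)·[ log(x/(n−x)) − ( ∫₀^{1/2} θ^x (1−θ)^{n−x} log(θ/(1−θ)) dθ ) / ( ∫₀^{1/2} θ^x (1−θ)^{n−x} dθ ) ]; consequently x is a critical point of E if and only if ( ∫₀^{1/2} θ^x (1−θ)^{n−x} log(θ/(1−θ)) dθ ) / ( ∫₀^{1/2} θ^x (1−θ)^{n−x} dθ ) = log(x/(n−x)) (the defining equation of the transition point TrP(E)). -/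
open MeasureTheory

/-- One-sided evidential volume with continuous parameters:
`V_E(n,x) = ∫₀^{1/2} 2^n θ^x (1−θ)^{n−x} dθ` (real powers). -/
noncomputable def VE1 (n x : ℝ) : ℝ :=
  ∫ θ in (0:ℝ)..(1/2), (2:ℝ) ^ n * θ ^ x * (1 - θ) ^ (n - x)

/-- Evidential entropy (additive constant `k = 0`). -/
noncomputable def SE1 (n x : ℝ) : ℝ :=
  x * Real.log (x / n) + (n - x) * Real.log ((n - x) / n) + n * Real.log 2

/-- One-sided evidence with `R = 1` and heat-capacity constant `C_V`:
`E = exp(S_E/C_V)/V_E^{1/C_V}`. -/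
noncomputable def Ev1 (CV n x : ℝ) : ℝ := Real.exp (SE1 n x / CV) / (VE1 n x) ^ (1 / CV)

theorem aux_I_deriv (n x : ℝ) (hx0 : 0 < x) (hxn : x < n) :
    HasDerivAt (fun y : ℝ => ∫ θ in (0:ℝ)..(1/2), θ ^ y * (1 - θ) ^ (n - y))
      (∫ θ in (0:ℝ)..(1/2), θ ^ x * (1 - θ) ^ (n - x) * Real.log (θ / (1 - θ))) x := by
  have hu : Set.uIoc (0:ℝ) (1/2) = Set.Ioc 0 (1/2) := Set.uIoc_of_le (by norm_num)
  refine (intervalIntegral.hasDerivAt_integral_of_dominated_loc_of_deriv_le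
    (F := fun y θ => θ ^ y * (1 - θ) ^ (n - y))
    (F' := fun y θ => θ ^ y * (1 - θ) ^ (n - y) * Real.log (θ / (1 - θ)))
    (bound := fun θ => - Real.log θ) (s := Set.Ioo 0 n) (μ := volume)
    (Ioo_mem_nhds hx0 hxn) ?_ ?_ ?_ ?_ ?_ ?_).2
  · refine Filter.Eventually.of_forall fun y => ?_
    exact (Measurable.aestronglyMeasurable (by fun_prop))
  · apply Continuous.intervalIntegrable
    exact (Real.continuous_rpow_const hx0.le).mul
      ((Real.continuous_rpow_const (by linarith)).comp (by fun_prop))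
  · exact (Measurable.aestronglyMeasurable (by fun_prop))
  · refine Filter.Eventually.of_forall fun θ hθ y hy => ?_
    rw [hu] at hθ
    obtain ⟨h0, h1⟩ := hθ
    have h2 : 0 < 1 - θ := by linarith
    have ha : 0 ≤ θ ^ y := Real.rpow_nonneg h0.le _
    have hb : 0 ≤ (1 - θ) ^ (n - y) := Real.rpow_nonneg h2.le _
    have ha1 : θ ^ y ≤ 1 := Real.rpow_le_one h0.le (by linarith) hy.1.le
    have hb1 : (1 - θ) ^ (n - y) ≤ 1 := Real.rpow_le_one h2.le (by linarith) (by linarith [hy.2])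
    have hl1 : Real.log θ ≤ Real.log (1 - θ) := Real.log_le_log h0 (by linarith)
    have hl2 : Real.log (1 - θ) ≤ 0 := Real.log_nonpos h2.le (by linarith)
    rw [Real.log_div h0.ne' h2.ne', norm_mul, Real.norm_of_nonneg (mul_nonneg ha hb),
      Real.norm_of_nonpos (by linarith)]
    have hab : θ ^ y * (1 - θ) ^ (n - y) ≤ 1 := mul_le_one₀ ha1 hb hb1
    nlinarith [mul_le_mul_of_nonneg_right hab (sub_nonneg.2 hl1)]
  · exact intervalIntegral.intervalIntegrable_log'.neg
  · refine Filter.Eventually.of_forall fun θ hθ y hy => ?_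
    rw [hu] at hθ
    obtain ⟨h0, h1⟩ := hθ
    have h2 : 0 < 1 - θ := by linarith
    have d1 := (hasDerivAt_id y).const_rpow h0
    have d2 := ((hasDerivAt_id y).const_sub n).const_rpow h2
    refine (d1.mul d2).congr_deriv ?_
    rw [Real.log_div h0.ne' h2.ne']
    simp only [id]
    ring

theorem aux_I_pos (n x : ℝ) (hx0 : 0 < x) (hxn : x < n) :
    0 < ∫ θ in (0:ℝ)..(1/2), θ ^ x * (1 - θ) ^ (n - x) := by
  apply intervalIntegral.intervalIntegral_pos_of_pos_on
  · apply Continuous.intervalIntegrable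
    exact (Real.continuous_rpow_const hx0.le).mul
      ((Real.continuous_rpow_const (by linarith)).comp (by fun_prop))
  · intro θ hθ
    exact mul_pos (Real.rpow_pos_of_pos hθ.1 _) (Real.rpow_pos_of_pos (by linarith [hθ.2]) _)
  · norm_num

theorem aux_VE (n x : ℝ) :
    VE1 n x = (2:ℝ) ^ n * ∫ θ in (0:ℝ)..(1/2), θ ^ x * (1 - θ) ^ (n - x) := by
  unfold VE1
  rw [← intervalIntegral.integral_const_mul]
  simp only [mul_assoc]

theorem aux_S (n x : ℝ) (hx0 : 0 < x) (hxn : x < n) :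
    HasDerivAt (fun y => SE1 n y) (Real.log (x / (n - x))) x := by
  have hn : 0 < n := hx0.trans hxn
  have h2 : 0 < n - x := by linarith
  have a := (hasDerivAt_id x).mul (((hasDerivAt_id x).div_const n).log (div_pos hx0 hn).ne')
  have e := (hasDerivAt_id x).const_sub n
  have b := e.mul ((e.div_const n).log (div_pos h2 hn).ne')
  refine ((a.add b).add_const (n * Real.log 2)).congr_deriv ?_
  simp only [id]
  rw [Real.log_div hx0.ne' hn.ne', Real.log_div h2.ne' hn.ne', Real.log_div hx0.ne' h2.ne']
  field_simp
  ring

/-- For fixed real `n > 0` and `C_V > 0`, on `0 < x < n/2` the function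
`log E` is differentiable with
`d/dx log E(x) = (1/C_V)·[log(x/(n−x)) − (∫₀^{1/2} θ^x(1−θ)^{n−x} log(θ/(1−θ)) dθ)/(∫₀^{1/2} θ^x(1−θ)^{n−x} dθ)]`;
consequently `x` is a critical point of `E` iff
`(∫₀^{1/2} θ^x(1−θ)^{n−x} log(θ/(1−θ)) dθ)/(∫₀^{1/2} θ^x(1−θ)^{n−x} dθ) = log(x/(n−x))`
(the defining equation of the transition point `TrP(E)`). -/
theorem log_evidence_deriv_and_transition_point (n CV : ℝ) (hn : 0 < n) (hCV : 0 < CV) :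
    ∀ x ∈ Set.Ioo (0:ℝ) (n / 2),
      HasDerivAt (fun y : ℝ => Real.log (Ev1 CV n y))
        ((1 / CV) * (Real.log (x / (n - x)) -
          (∫ θ in (0:ℝ)..(1/2), θ ^ x * (1 - θ) ^ (n - x) * Real.log (θ / (1 - θ))) /
            (∫ θ in (0:ℝ)..(1/2), θ ^ x * (1 - θ) ^ (n - x)))) x ∧
      (deriv (fun y : ℝ => Ev1 CV n y) x = 0 ↔
        (∫ θ in (0:ℝ)..(1/2), θ ^ x * (1 - θ) ^ (n - x) * Real.log (θ / (1 - θ))) /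
            (∫ θ in (0:ℝ)..(1/2), θ ^ x * (1 - θ) ^ (n - x)) =
          Real.log (x / (n - x))) := by
  intro x hx
  obtain ⟨hx0, hx1⟩ := hx
  have hxn : x < n := by linarith
  have hI := aux_I_pos n x hx0 hxn
  have hV : ∀ y, 0 < y → y < n → 0 < VE1 n y := fun y h h' => by
    rw [aux_VE]
    exact mul_pos (Real.rpow_pos_of_pos two_pos _) (aux_I_pos n y h h')
  have dV : HasDerivAt (fun y => VE1 n y) _ x :=
    ((aux_I_deriv n x hx0 hxn).const_mul ((2:ℝ) ^ n)).congr_of_eventuallyEq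
      (Filter.Eventually.of_forall fun y => aux_VE n y)
  have dG := ((aux_S n x hx0 hxn).sub (dV.log (hV x hx0 hxn).ne')).const_mul (1 / CV)
  have hev : ∀ᶠ y in nhds x, y ∈ Set.Ioo 0 n := Ioo_mem_nhds hx0 hxn
  have hlog : HasDerivAt (fun y : ℝ => Real.log (Ev1 CV n y))
        ((1 / CV) * (Real.log (x / (n - x)) -
          (∫ θ in (0:ℝ)..(1/2), θ ^ x * (1 - θ) ^ (n - x) * Real.log (θ / (1 - θ))) /
            (∫ θ in (0:ℝ)..(1/2), θ ^ x * (1 - θ) ^ (n - x)))) x := by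
    refine (dG.congr_of_eventuallyEq ?_).congr_deriv ?_
    · filter_upwards [hev] with y hy
      have h := hV y hy.1 hy.2
      unfold Ev1
      rw [Real.log_div (Real.exp_pos _).ne' (Real.rpow_pos_of_pos h _).ne', Real.log_exp,
        Real.log_rpow h]
      simp only [Pi.sub_apply]
      ring
    · rw [aux_VE, mul_div_mul_left _ _ (Real.rpow_pos_of_pos two_pos n).ne']
  refine ⟨hlog, ?_⟩
  have hE : ∀ y, 0 < y → y < n → 0 < Ev1 CV n y := fun y h h' =>
    div_pos (Real.exp_pos _) (Real.rpow_pos_of_pos (hV y h h') _)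
  have dE := hlog.exp.congr_of_eventuallyEq (f₁ := fun y : ℝ => Ev1 CV n y) (by
    filter_upwards [hev] with y hy
    exact (Real.exp_log (hE y hy.1 hy.2)).symm)
  rw [dE.deriv, mul_eq_zero, mul_eq_zero, sub_eq_zero]
  have h1 := (Real.exp_pos (Real.log (Ev1 CV n x))).ne'
  have h2 : 1 / CV ≠ 0 := (one_div_pos.2 hCV).ne'
  simp only [h1, h2, false_or]
  exact eq_comm
end

section
/- Let t ∈ (0, 1/2) and let (x_n) be a sequence of natural numbers with x_n/n → t as n → ∞. Then the mass of the likelihood on [1/2, 1] is asymptotically negligible: ( ∫_{1/2}^1 θ^{x_n} (1−θ)^{n−x_n} dθ ) / ( ∫_0^1 θ^{x_n} (1−θ)^{n−x_n} dθ ) → 0 as n → ∞. -/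
open MeasureTheory Filter

lemma beta_aux_s13 (x m : ℕ) (μ c : ℝ) (hμ : μ * (x + m + 2) = x + 1) (hc : 0 < c)
    (hcμ : c ≤ 1/2 - μ) :
    (∫ θ in (1/2:ℝ)..1, θ ^ x * (1 - θ) ^ m) ≤
      1 / (4 * c ^ 2 * (x + m + 2)) * (∫ θ in (0:ℝ)..1, θ ^ x * (1 - θ) ^ m) := by
  have hid : ∫ θ in (0:ℝ)..1, (θ ^ x * (1 - θ) ^ m * (θ * (1 - θ))
      - (x + m + 2) * (θ ^ x * (1 - θ) ^ m * (θ - μ) ^ 2)) = 0 := by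
    have h := intervalIntegral.integral_eq_sub_of_hasDerivAt (a := (0:ℝ)) (b := 1)
      (f := fun θ : ℝ => θ ^ (x+1) * (1 - θ) ^ (m+1) * (θ - μ))
      (f' := fun θ : ℝ => θ ^ x * (1 - θ) ^ m * (θ * (1 - θ))
      - (x + m + 2) * (θ ^ x * (1 - θ) ^ m * (θ - μ) ^ 2)) ?_
      (Continuous.intervalIntegrable (by fun_prop) _ _)
    · rw [h]; simp
    · intro θ _
      have h1 := (hasDerivAt_id θ).pow (x+1)
      have h2 := ((hasDerivAt_id θ).const_sub 1).pow (m+1)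
      have h3 := (hasDerivAt_id θ).sub_const μ
      refine ((h1.mul h2).mul h3).congr_deriv ?_
      simp only [id, Pi.mul_apply, Pi.pow_apply, Nat.add_sub_cancel]
      push_cast
      linear_combination (- θ ^ x * (1 - θ) ^ m * (θ - μ)) * hμ
  rw [intervalIntegral.integral_sub (Continuous.intervalIntegrable (by fun_prop) _ _)
    (Continuous.intervalIntegrable (by fun_prop) _ _),
    intervalIntegral.integral_const_mul] at hid
  have hq : (∫ θ in (0:ℝ)..1, θ ^ x * (1 - θ) ^ m * (θ * (1 - θ))) ≤
      ∫ θ in (0:ℝ)..1, (1/4) * (θ ^ x * (1 - θ) ^ m) := by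
    apply intervalIntegral.integral_mono_on (by norm_num)
      (Continuous.intervalIntegrable (by fun_prop) _ _)
      (Continuous.intervalIntegrable (by fun_prop) _ _)
    intro θ hθ
    have : 0 ≤ θ ^ x * (1 - θ) ^ m :=
      mul_nonneg (pow_nonneg hθ.1 _) (pow_nonneg (by linarith [hθ.2]) _)
    nlinarith [mul_nonneg this (sq_nonneg (θ - 1/2))]
  rw [intervalIntegral.integral_const_mul] at hq
  have hu : (∫ θ in (1/2:ℝ)..1, c ^ 2 * (θ ^ x * (1 - θ) ^ m)) ≤
      ∫ θ in (1/2:ℝ)..1, θ ^ x * (1 - θ) ^ m * (θ - μ) ^ 2 := by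
    apply intervalIntegral.integral_mono_on (by norm_num)
      (Continuous.intervalIntegrable (by fun_prop) _ _)
      (Continuous.intervalIntegrable (by fun_prop) _ _)
    intro θ hθ
    have h0 : 0 ≤ θ ^ x * (1 - θ) ^ m :=
      mul_nonneg (pow_nonneg (by linarith [hθ.1]) _) (pow_nonneg (by linarith [hθ.2]) _)
    have : c ^ 2 ≤ (θ - μ) ^ 2 := pow_le_pow_left₀ hc.le (by linarith [hθ.1]) 2
    nlinarith
  rw [intervalIntegral.integral_const_mul] at hu
  have hl : 0 ≤ ∫ θ in (0:ℝ)..(1/2), θ ^ x * (1 - θ) ^ m * (θ - μ) ^ 2 := by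
    apply intervalIntegral.integral_nonneg (by norm_num)
    intro θ hθ
    exact mul_nonneg (mul_nonneg (pow_nonneg hθ.1 _) (pow_nonneg (by linarith [hθ.2]) _))
      (sq_nonneg _)
  have hs := intervalIntegral.integral_add_adjacent_intervals (μ := volume)
    (a := (0:ℝ)) (b := 1/2) (c := 1) (f := fun θ : ℝ => θ ^ x * (1 - θ) ^ m * (θ - μ) ^ 2)
    (Continuous.intervalIntegrable (by fun_prop) _ _)
    (Continuous.intervalIntegrable (by fun_prop) _ _)
  have hN : (0:ℝ) < x + m + 2 := by positivity
  rw [one_div_mul_eq_div, le_div_iff₀ (by positivity)]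
  have := mul_le_mul_of_nonneg_left (hu.trans (by linarith only [hl, hs] :
    _ ≤ ∫ θ in (0:ℝ)..1, θ ^ x * (1 - θ) ^ m * (θ - μ) ^ 2)) hN.le
  linarith


/-- If `x_n/n → t ∈ (0, 1/2)`, then the mass of the binomial likelihood
on `[1/2, 1]` is asymptotically negligible:
`(∫_{1/2}^1 θ^{x_n}(1−θ)^{n−x_n} dθ)/(∫_0^1 θ^{x_n}(1−θ)^{n−x_n} dθ) → 0`. -/
theorem upper_tail_negligible (t : ℝ) (ht : t ∈ Set.Ioo (0:ℝ) (1/2)) (x : ℕ → ℕ)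
    (hlim : Tendsto (fun n : ℕ => (x n : ℝ) / n) atTop (nhds t)) :
    Tendsto
      (fun n : ℕ =>
        (∫ θ in (1/2:ℝ)..1, θ ^ (x n) * (1 - θ) ^ (n - x n)) /
          (∫ θ in (0:ℝ)..1, θ ^ (x n) * (1 - θ) ^ (n - x n)))
      atTop (nhds 0) := by
  obtain ⟨_, ht2⟩ := ht
  set c : ℝ := (1/2 - (t + 1/2)/2) / 3 with hcdef
  have hc : 0 < c := by rw [hcdef]; linarith
  have hev : ∀ᶠ n : ℕ in atTop, (x n : ℝ) / n < (t + 1/2)/2 :=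
    hlim.eventually (gt_mem_nhds (by linarith))
  have hlim2 : Tendsto (fun n : ℕ => 1 / (4 * c ^ 2) * (1 / ((n:ℝ) + 1))) atTop (nhds 0) := by
    have h := (tendsto_one_div_add_atTop_nhds_zero_nat (𝕜 := ℝ)).const_mul (1 / (4 * c ^ 2))
    rwa [mul_zero] at h
  have hnn : ∀ n : ℕ, ∀ a : ℝ, 0 ≤ a → a ≤ 1 →
      0 ≤ ∫ θ in a..1, θ ^ (x n) * (1 - θ) ^ (n - x n) := by
    intro n a ha ha1
    apply intervalIntegral.integral_nonneg ha1
    intro θ hθ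
    exact mul_nonneg (pow_nonneg (by linarith [hθ.1]) _) (pow_nonneg (by linarith [hθ.2]) _)
  refine squeeze_zero' (Eventually.of_forall fun n => div_nonneg
    (hnn n _ (by norm_num) (by norm_num)) (hnn n _ le_rfl (by norm_num))) ?_ hlim2
  filter_upwards [hev, eventually_ge_atTop 1] with n hn h1
  have h1r : (1:ℝ) ≤ n := by exact_mod_cast h1
  rw [div_lt_iff₀ (by linarith)] at hn
  have hxn : x n ≤ n := by
    have : (x n : ℝ) ≤ n := by nlinarith
    exact_mod_cast this
  have hcast : ((n - x n : ℕ) : ℝ) = n - x n := by push_cast [hxn]; ring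
  refine div_le_of_le_mul₀ (hnn n _ le_rfl (by norm_num)) (by positivity) ?_
  refine (beta_aux_s13 (x n) (n - x n) ((x n + 1) / (n + 2)) c ?_ hc ?_).trans ?_
  · rw [hcast]; field_simp; ring
  · have : (1:ℝ)/2 - (x n + 1) / (n + 2) = (n / 2 - x n) / (n + 2) := by field_simp; ring
    rw [this, le_div_iff₀ (by linarith)]
    have h3 : (1/2 - (t + 1/2)/2) = 3 * c := by rw [hcdef]; ring
    nlinarith
  · apply mul_le_mul_of_nonneg_right _ (hnn n _ le_rfl (by norm_num))
    rw [hcast, one_div_mul_one_div]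
    apply one_div_le_one_div_of_le (by positivity)
    apply mul_le_mul_of_nonneg_left _ (by positivity)
    linarith
end
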